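/- Let (X_n)_{n≥1} be a sequence of pairwise independent, integrable real-valued random variables and set G(x) = sup_{n≥1} (1/n) ∑_{k=1}^{n} P(|X_k| > x) for x ≥ 0. If ∫_0^∞ G(x) dx < ∞ and ∑_{n=1}^∞ P(|X_n| > n) < ∞, then (S_n − E S_n)/n → 0 almost surely, where S_n = ∑_{k=1}^{n} X_k. -/

import Mathlib

open MeasureTheory ProbabilityTheory Filter ENNReal

/-- A monotone sequence `S` stays close to a centering `e` whose increments are controlled, as soon
as it does so along all the geometric subsequences `⌊c ^ n⌋₊` with `c = 1 + 1 / (j + 1)`. -/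
lemma tendsto_sub_div_of_tendsto_floor_pow {S e : ℕ → ℝ} (hS : Monotone S) (he : Monotone e)
    (hinc : ∀ η : ℝ, 0 < η → ∃ M : ℝ, 0 ≤ M ∧ ∀ N N' : ℕ, N ≤ N' →
      e N' - e N ≤ M * ((N' : ℝ) - N) + η * N')
    (hsub : ∀ j : ℕ, Tendsto (fun n : ℕ =>
      (S ⌊(1 + 1 / ((j : ℝ) + 1)) ^ n⌋₊ - e ⌊(1 + 1 / ((j : ℝ) + 1)) ^ n⌋₊) /
        (⌊(1 + 1 / ((j : ℝ) + 1)) ^ n⌋₊ : ℝ)) atTop (nhds 0)) :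
    Tendsto (fun n : ℕ => (S n - e n) / (n : ℝ)) atTop (nhds 0) := by
  rw [Metric.tendsto_atTop]
  intro ε hε
  obtain ⟨M, hM0, hM⟩ := hinc (ε / 32) (by positivity)
  obtain ⟨j, hj⟩ := exists_nat_gt (M / (ε / 4))
  have hj1 : M * (1 / ((j : ℝ) + 1)) ≤ ε / 4 := by
    rw [div_lt_iff₀ (by positivity)] at hj
    rw [mul_one_div, div_le_iff₀ (by positivity)]
    nlinarith
  have hd1 : 1 / ((j : ℝ) + 1) ≤ 1 := by
    rw [div_le_one (by positivity)]; linarith [Nat.cast_nonneg (α := ℝ) j]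
  have hd0 : 0 < 1 / ((j : ℝ) + 1) := by positivity
  have hj2 := hsub j
  set d : ℝ := 1 / ((j : ℝ) + 1) with hd
  clear_value d
  obtain ⟨n₀, hn₀⟩ := (Metric.tendsto_atTop.1 hj2) (ε / 32) (by positivity)
  obtain ⟨m₁, hm₁⟩ := exists_nat_ge ((1 + d) ^ (n₀ + 1))
  obtain ⟨m₂, hm₂⟩ := exists_nat_gt (2 * M / (ε / 8))
  refine ⟨max m₁ (max m₂ 1), fun m hm => ?_⟩
  have hm1 : m₁ ≤ m := (le_max_left _ _).trans hm
  have hm2 : m₂ ≤ m := ((le_max_left _ _).trans (le_max_right _ _)).trans hm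
  have hm3 : 1 ≤ m := ((le_max_right _ _).trans (le_max_right _ _)).trans hm
  have hm1' : (m₁ : ℝ) ≤ m := by exact_mod_cast hm1
  have hm2' : (m₂ : ℝ) ≤ m := by exact_mod_cast hm2
  have hm3' : (1 : ℝ) ≤ m := by exact_mod_cast hm3
  obtain ⟨n, hn, hn'⟩ := exists_nat_pow_near hm3' (show 1 < 1 + d by linarith)
  have hnn : n₀ ≤ n := by
    have : (1 + d) ^ (n₀ + 1) < (1 + d) ^ (n + 1) := by linarith
    have := (pow_lt_pow_iff_right₀ (show 1 < 1 + d by linarith)).1 this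
    omega
  have a1 := hn₀ n hnn
  have a2 := hn₀ (n + 1) (by omega)
  have hp : 1 ≤ (1 + d) ^ n := one_le_pow₀ (by linarith)
  have hp' : 1 ≤ (1 + d) ^ (n + 1) := one_le_pow₀ (by linarith)
  have b1 : (⌊(1 + d) ^ n⌋₊ : ℝ) ≤ (1 + d) ^ n := Nat.floor_le (by linarith)
  have b2 : (1 + d) ^ n < (⌊(1 + d) ^ n⌋₊ : ℝ) + 1 := Nat.lt_floor_add_one _
  have b3 : (⌊(1 + d) ^ (n + 1)⌋₊ : ℝ) ≤ (1 + d) ^ n * (1 + d) :=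
    (Nat.floor_le (by linarith)).trans_eq (pow_succ _ _)
  have b4 : m ≤ ⌊(1 + d) ^ (n + 1)⌋₊ := Nat.le_floor hn'.le
  have b5 : ⌊(1 + d) ^ n⌋₊ ≤ m := by
    have : (⌊(1 + d) ^ n⌋₊ : ℝ) ≤ m := by linarith
    exact_mod_cast this
  have b6 : 1 ≤ ⌊(1 + d) ^ n⌋₊ := Nat.le_floor (by simpa using hp)
  generalize ⌊(1 + d) ^ n⌋₊ = N at *
  generalize ⌊(1 + d) ^ (n + 1)⌋₊ = N' at *
  have b5' : (N : ℝ) ≤ m := by exact_mod_cast b5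
  have b6' : (1 : ℝ) ≤ N := by exact_mod_cast b6
  have b4' : (m : ℝ) ≤ N' := by exact_mod_cast b4
  have c1 : (N' : ℝ) - N ≤ d * m + 2 := by
    have h1 := mul_le_mul_of_nonneg_right b2.le (show 0 ≤ 1 + d by linarith)
    have h2 := mul_le_mul_of_nonneg_left b5' hd0.le
    linarith
  have c2 : (N' : ℝ) ≤ 4 * m := by
    have := mul_le_mul_of_nonneg_right hd1 (Nat.cast_nonneg (α := ℝ) m)
    linarith
  rw [dist_zero_right, Real.norm_eq_abs, abs_div, Nat.abs_cast,
    div_lt_iff₀ (by linarith), abs_lt] at a1 a2 ⊢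
  have h1 := hM N N' (b5.trans b4)
  have s1 := hS b4
  have s2 := hS b5
  have e1 := he b4
  have e2 := he b5
  have c3 : M * ((N' : ℝ) - N) ≤ ε / 4 * m + 2 * M := by
    have h1 := mul_le_mul_of_nonneg_left c1 hM0
    have h2 := mul_le_mul_of_nonneg_right hj1 (Nat.cast_nonneg (α := ℝ) m)
    linarith
  have c4 : 2 * M < ε / 8 * m := by
    rw [div_lt_iff₀ (by positivity)] at hm₂
    have := mul_le_mul_of_nonneg_right hm2' (show 0 ≤ ε / 8 by positivity)
    linarith
  have c5 : ε / 32 * (N' : ℝ) ≤ ε / 8 * m := by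
    have := mul_le_mul_of_nonneg_left c2 (show 0 ≤ ε / 32 by positivity)
    linarith
  have c6 : ε / 32 * (N : ℝ) ≤ ε / 8 * m := by
    have := mul_le_mul_of_nonneg_left (b4'.trans c2) (show 0 ≤ ε / 32 by positivity)
    have := mul_le_mul_of_nonneg_left b5' (show 0 ≤ ε / 32 by positivity)
    linarith
  have c7 : 0 < ε * m := by positivity
  constructor <;> linarith

lemma exists_mul_tsum_inv_floor_pow_le {c : ℝ} (hc : 1 < c) :
    ∃ C : ℝ≥0∞, C ≠ ⊤ ∧ ∀ t : ℝ, 0 < t →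
      ENNReal.ofReal t * ∑' n : ℕ,
        (if t < (⌊c ^ n⌋₊ : ℝ) then ((⌊c ^ n⌋₊ : ℝ≥0∞))⁻¹ else 0) ≤ C := by
  have hc1 : 0 < 1 - c⁻¹ := by
    have := inv_lt_one_of_one_lt₀ hc
    linarith
  refine ⟨ENNReal.ofReal (1 - c⁻¹)⁻¹ * (1 - ENNReal.ofReal c⁻¹)⁻¹, ?_, fun t ht => ?_⟩
  · refine ENNReal.mul_ne_top ENNReal.ofReal_ne_top (ENNReal.inv_ne_top.2 ?_)
    rw [Ne, tsub_eq_zero_iff_le, not_le, ENNReal.ofReal_lt_one]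
    linarith
  rw [← ENNReal.tsum_mul_left]
  by_cases hex : ∃ n : ℕ, t < (⌊c ^ n⌋₊ : ℝ)
  · classical
    set m := Nat.find hex
    have hm : t < (⌊c ^ m⌋₊ : ℝ) := Nat.find_spec hex
    have hlt : ∀ n < m, ¬ t < (⌊c ^ n⌋₊ : ℝ) := fun n hn => Nat.find_min hex hn
    rw [← Summable.sum_add_tsum_nat_add' (k := m) ENNReal.summable,
      Finset.sum_eq_zero, zero_add, ← ENNReal.tsum_geometric, ← ENNReal.tsum_mul_left]
    · refine ENNReal.tsum_le_tsum fun i => ?_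
      have hk := mul_pow_le_nat_floor_pow hc (i + m)
      have hkpos : 0 < (1 - c⁻¹) * c ^ (i + m) := by positivity
      have hkpos' : (0 : ℝ) < ⌊c ^ (i + m)⌋₊ := by linarith
      have hle : (⌊c ^ m⌋₊ : ℝ) ≤ c ^ m := Nat.floor_le (by positivity)
      split_ifs
      · rw [← ENNReal.ofReal_natCast, ← ENNReal.ofReal_inv_of_pos hkpos',
          ← ENNReal.ofReal_mul ht.le, ← ENNReal.ofReal_pow (by positivity),
          ← ENNReal.ofReal_mul (by positivity)]
        apply ENNReal.ofReal_le_ofReal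
        calc t * (⌊c ^ (i + m)⌋₊ : ℝ)⁻¹ ≤ c ^ m * ((1 - c⁻¹) * c ^ (i + m))⁻¹ := by
              gcongr
              linarith
          _ = (1 - c⁻¹)⁻¹ * c⁻¹ ^ i := by
              have : c ^ i ≠ 0 := by positivity
              rw [pow_add, inv_pow]
              field_simp
      · simp
    · intro n hn
      rw [if_neg (hlt n (Finset.mem_range.1 hn)), mul_zero]
  · push Not at hex
    simp [fun n => (hex n).not_gt]

section Nonneg

variable {Ω : Type*} [MeasurableSpace Ω] {μ : Measure Ω} {Z : ℕ → Ω → ℝ} {g : ℝ → ℝ≥0∞}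

lemma sum_lintegral_max_sub_le (hmeas : ∀ n, Measurable (Z n))
    (hg : Measurable g)
    (hZg : ∀ (n : ℕ) (t : ℝ), 0 < t → ∑ k ∈ Finset.Icc 1 n, μ {ω | t < Z k ω} ≤ n * g t)
    {M : ℝ} (hM : 0 ≤ M) (N : ℕ) :
    ∑ k ∈ Finset.Icc 1 N, ∫⁻ ω, ENNReal.ofReal (max (Z k ω - M) 0) ∂μ ≤
      N * ∫⁻ t in Set.Ioi M, g t := by
  have key : ∀ k, ∫⁻ ω, ENNReal.ofReal (max (Z k ω - M) 0) ∂μ =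
      ∫⁻ t in Set.Ioi (0 : ℝ), μ {ω | t + M < Z k ω} := by
    intro k
    rw [lintegral_eq_lintegral_meas_lt (f := fun ω => max (Z k ω - M) 0) μ
      (ae_of_all _ fun ω => le_max_right _ _)
      (((hmeas k).sub_const M).max measurable_const).aemeasurable]
    refine setLIntegral_congr_fun measurableSet_Ioi fun t ht => ?_
    have ht : 0 < t := ht
    congr 1
    ext ω
    simp only [Set.mem_ofPred_eq, lt_max_iff]
    exact ⟨fun h => by rcases h with h | h <;> linarith, fun h => Or.inl (by linarith)⟩
  have hm : ∀ k, Measurable fun t : ℝ => μ {ω | t + M < Z k ω} := fun k =>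
    Antitone.measurable fun s t hst => measure_mono fun ω (h : t + M < Z k ω) =>
      show s + M < Z k ω by linarith
  simp_rw [key]
  rw [← lintegral_finsetSum _ fun k _ => hm k]
  calc ∫⁻ t in Set.Ioi (0 : ℝ), ∑ k ∈ Finset.Icc 1 N, μ {ω | t + M < Z k ω}
      ≤ ∫⁻ t in Set.Ioi (0 : ℝ), N * g (t + M) :=
        setLIntegral_mono' measurableSet_Ioi fun t (ht : 0 < t) => hZg N (t + M) (by linarith)
    _ = N * ∫⁻ t in Set.Ioi (0 : ℝ), g (t + M) :=
        lintegral_const_mul _ (hg.comp (measurable_add_const M))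
    _ = N * ∫⁻ t in Set.Ioi M, g t := by
        rw [← (measurePreserving_add_right volume M).setLIntegral_comp_preimage
          measurableSet_Ioi hg]
        simp

lemma exists_setLIntegral_Ioi_le (hg : Measurable g)
    (hfin : ∫⁻ t in Set.Ioi (0 : ℝ), g t ≠ ⊤) {η : ℝ} (hη : 0 < η) :
    ∃ M : ℝ, 0 ≤ M ∧ ∫⁻ t in Set.Ioi M, g t ≤ ENNReal.ofReal η := by
  have h : Tendsto (fun n : ℕ => ∫⁻ t in Set.Ioi (0 : ℝ), (Set.Ioi (n : ℝ)).indicator g t) atTop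
      (nhds (∫⁻ _ in Set.Ioi (0 : ℝ), 0)) := by
    refine tendsto_lintegral_of_dominated_convergence g
      (fun n => hg.indicator measurableSet_Ioi)
      (fun n => ae_of_all _ fun t => Set.indicator_le_self _ _ _) hfin (ae_of_all _ fun t => ?_)
    obtain ⟨n₀, hn₀⟩ := exists_nat_ge t
    refine tendsto_const_nhds.congr' ?_
    filter_upwards [eventually_ge_atTop n₀] with n hn
    have : (n₀ : ℝ) ≤ n := by exact_mod_cast hn
    rw [Set.indicator_of_notMem]
    simp only [Set.mem_Ioi, not_lt]
    linarith
  rw [lintegral_zero] at h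
  obtain ⟨n, hn⟩ := (h.eventually_lt_const (ENNReal.ofReal_pos.2 hη)).exists
  refine ⟨n, Nat.cast_nonneg n, le_of_eq_of_le ?_ hn.le⟩
  rw [lintegral_indicator measurableSet_Ioi, Measure.restrict_restrict measurableSet_Ioi,
    Set.inter_eq_left.2 (Set.Ioi_subset_Ioi (Nat.cast_nonneg n))]

/-- Cesàro uniform integrability. -/
lemma exists_sum_integral_max_sub_le [IsFiniteMeasure μ] (hmeas : ∀ n, Measurable (Z n))
    (hint : ∀ n, 1 ≤ n → Integrable (Z n) μ) (hg : Measurable g)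
    (hfin : ∫⁻ t in Set.Ioi (0 : ℝ), g t ≠ ⊤)
    (hZg : ∀ (n : ℕ) (t : ℝ), 0 < t → ∑ k ∈ Finset.Icc 1 n, μ {ω | t < Z k ω} ≤ n * g t)
    {η : ℝ} (hη : 0 < η) :
    ∃ M : ℝ, 0 ≤ M ∧ ∀ N : ℕ,
      ∑ k ∈ Finset.Icc 1 N, ∫ ω, max (Z k ω - M) 0 ∂μ ≤ η * N := by
  obtain ⟨M, hM, hMη⟩ := exists_setLIntegral_Ioi_le hg hfin hη
  refine ⟨M, hM, fun N => ?_⟩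
  rw [← ENNReal.ofReal_le_ofReal_iff (by positivity), ENNReal.ofReal_sum_of_nonneg
    fun k _ => integral_nonneg (f := fun ω => max (Z k ω - M) 0) fun ω => le_max_right _ _]
  calc ∑ k ∈ Finset.Icc 1 N, ENNReal.ofReal (∫ ω, max (Z k ω - M) 0 ∂μ)
      = ∑ k ∈ Finset.Icc 1 N, ∫⁻ ω, ENNReal.ofReal (max (Z k ω - M) 0) ∂μ := by
        refine Finset.sum_congr rfl fun k hk => ofReal_integral_eq_lintegral_ofReal ?_
          (ae_of_all _ fun ω => le_max_right _ _)
        exact ((hint k (Finset.mem_Icc.1 hk).1).sub (integrable_const M)).pos_part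
    _ ≤ N * ∫⁻ t in Set.Ioi M, g t := sum_lintegral_max_sub_le hmeas hg hZg hM N
    _ ≤ N * ENNReal.ofReal η := by gcongr
    _ = ENNReal.ofReal (η * N) := by
        rw [ENNReal.ofReal_mul hη.le, ENNReal.ofReal_natCast, mul_comm]

lemma lintegral_truncation_sq_le (hmeas : ∀ n, Measurable (Z n)) (h0 : ∀ n ω, 0 ≤ Z n ω)
    {k N : ℕ} (hk : k ≤ N) :
    ∫⁻ ω, ENNReal.ofReal (truncation (Z k) k ω ^ 2) ∂μ ≤
      2 * ∫⁻ t in Set.Ioi (0 : ℝ),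
        (Set.Iio (N : ℝ)).indicator (fun t => μ {ω | t < Z k ω} * ENNReal.ofReal t) t := by
  have hY : Measurable (truncation (Z k) k) :=
    (measurable_id.indicator measurableSet_Ioc).comp (hmeas k)
  have h := lintegral_rpow_eq_lintegral_meas_lt_mul μ
    (ae_of_all _ fun ω => truncation_nonneg (f := Z k) k (h0 k ω)) hY.aemeasurable
    (p := 2) two_pos
  simp only [Real.rpow_two, ENNReal.ofReal_ofNat] at h
  rw [h]
  gcongr 2 * ?_
  refine setLIntegral_mono' measurableSet_Ioi fun t (ht : 0 < t) => ?_
  have hone : t ^ ((2 : ℝ) - 1) = t := by norm_num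
  rw [hone]
  have hle : ∀ ω, truncation (Z k) k ω ≤ Z k ω := fun ω => by
    have := abs_truncation_le_abs_self (Z k) k ω
    rw [abs_of_nonneg (h0 k ω)] at this
    exact (le_abs_self _).trans this
  by_cases htN : t < N
  · rw [Set.indicator_of_mem (Set.mem_Iio.2 htN)]
    gcongr with ω
    exact hle ω
  · have : {ω | t < truncation (Z k) k ω} = ∅ := by
      ext ω
      have h1 := abs_truncation_le_bound (Z k) k ω
      have h2 : (k : ℝ) ≤ N := by exact_mod_cast hk
      rw [Nat.abs_cast] at h1
      simp only [Set.mem_ofPred_eq, Set.mem_empty_iff_false, iff_false, not_lt]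
      linarith [le_abs_self (truncation (Z k) k ω)]
    simp [this]

lemma evariance_sum_truncation_le [IsProbabilityMeasure μ] (hmeas : ∀ n, Measurable (Z n))
    (h0 : ∀ n ω, 0 ≤ Z n ω) (hindep : ∀ i j, i ≠ j → IndepFun (Z i) (Z j) μ)
    (hg : Measurable g)
    (hZg : ∀ (n : ℕ) (t : ℝ), 0 < t → ∑ k ∈ Finset.Icc 1 n, μ {ω | t < Z k ω} ≤ n * g t)
    (N : ℕ) :
    evariance (∑ k ∈ Finset.Icc 1 N, truncation (Z k) k) μ ≤
      N * (2 * ∫⁻ t in Set.Ioi (0 : ℝ),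
        (Set.Iio (N : ℝ)).indicator (fun t => g t * ENNReal.ofReal t) t) := by
  have hL : ∀ k, MemLp (truncation (Z k) k) 2 μ := fun k =>
    (hmeas k).aestronglyMeasurable.memLp_truncation
  have hm : ∀ k, Measurable fun t : ℝ => μ {ω | t < Z k ω} := fun k =>
    Antitone.measurable fun s t hst => measure_mono fun ω (h : t < Z k ω) => hst.trans_lt h
  rw [← MemLp.ofReal_variance_eq (memLp_finsetSum' _ fun k _ => hL k),
    IndepFun.variance_sum (fun k _ => hL k) fun i _ j _ hij =>
      (hindep i j hij).comp (measurable_id.indicator measurableSet_Ioc)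
        (measurable_id.indicator measurableSet_Ioc),
    ENNReal.ofReal_sum_of_nonneg fun k _ => variance_nonneg _ _]
  calc ∑ k ∈ Finset.Icc 1 N, ENNReal.ofReal (variance (truncation (Z k) k) μ)
      ≤ ∑ k ∈ Finset.Icc 1 N, 2 * ∫⁻ t in Set.Ioi (0 : ℝ),
        (Set.Iio (N : ℝ)).indicator (fun t => μ {ω | t < Z k ω} * ENNReal.ofReal t) t := by
        refine Finset.sum_le_sum fun k hk => ?_
        refine le_trans ?_ (lintegral_truncation_sq_le hmeas h0 (Finset.mem_Icc.1 hk).2)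
        rw [← ofReal_integral_eq_lintegral_ofReal (hL k).integrable_sq
          (ae_of_all _ fun ω => sq_nonneg _)]
        exact ENNReal.ofReal_le_ofReal
          (variance_le_expectation_sq (hL k).aestronglyMeasurable)
    _ = 2 * ∫⁻ t in Set.Ioi (0 : ℝ), ∑ k ∈ Finset.Icc 1 N,
        (Set.Iio (N : ℝ)).indicator (fun t => μ {ω | t < Z k ω} * ENNReal.ofReal t) t := by
        rw [← Finset.mul_sum, lintegral_finsetSum]
        exact fun k _ => ((hm k).mul ENNReal.measurable_ofReal).indicator measurableSet_Iio
    _ ≤ 2 * ∫⁻ t in Set.Ioi (0 : ℝ),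
        N * (Set.Iio (N : ℝ)).indicator (fun t => g t * ENNReal.ofReal t) t := by
        gcongr 2 * ?_
        refine setLIntegral_mono' measurableSet_Ioi fun t (ht : 0 < t) => ?_
        by_cases htN : t < N
        · simp only [Set.indicator_of_mem (Set.mem_Iio.2 htN)]
          rw [← Finset.sum_mul, ← mul_assoc]
          gcongr
          exact hZg N t ht
        · simp [Set.indicator_of_notMem (show t ∉ Set.Iio (N : ℝ) from htN)]
    _ = N * (2 * ∫⁻ t in Set.Ioi (0 : ℝ),
        (Set.Iio (N : ℝ)).indicator (fun t => g t * ENNReal.ofReal t) t) := by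
        rw [lintegral_const_mul _
          (Measurable.indicator (f := fun t => g t * ENNReal.ofReal t)
            (hg.mul ENNReal.measurable_ofReal) measurableSet_Iio), mul_left_comm]

lemma ae_tendsto_sum_truncation_floor_pow [IsProbabilityMeasure μ]
    (hmeas : ∀ n, Measurable (Z n))
    (h0 : ∀ n ω, 0 ≤ Z n ω) (hindep : ∀ i j, i ≠ j → IndepFun (Z i) (Z j) μ)
    (hg : Measurable g) (hfin : ∫⁻ t in Set.Ioi (0 : ℝ), g t ≠ ⊤)
    (hZg : ∀ (n : ℕ) (t : ℝ), 0 < t → ∑ k ∈ Finset.Icc 1 n, μ {ω | t < Z k ω} ≤ n * g t)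
    {c : ℝ} (hc : 1 < c) :
    ∀ᵐ ω ∂μ, Tendsto (fun n : ℕ =>
      (∑ k ∈ Finset.Icc 1 ⌊c ^ n⌋₊, truncation (Z k) k ω -
        ∑ k ∈ Finset.Icc 1 ⌊c ^ n⌋₊, ∫ ω', truncation (Z k) k ω' ∂μ) / (⌊c ^ n⌋₊ : ℝ))
      atTop (nhds 0) := by
  obtain ⟨C, hC, hCle⟩ := exists_mul_tsum_inv_floor_pow_le hc
  have hk1 : ∀ n : ℕ, 1 ≤ ⌊c ^ n⌋₊ := fun n => Nat.le_floor (by simpa using one_le_pow₀ hc.le)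
  have hY : ∀ k, Measurable (truncation (Z k) k) := fun k =>
    (measurable_id.indicator measurableSet_Ioc).comp (hmeas k)
  have hI : ∀ k, Integrable (truncation (Z k) k) μ := fun k =>
    (hmeas k).aestronglyMeasurable.integrable_truncation
  set D : ℕ → Ω → ℝ := fun N ω => ∑ k ∈ Finset.Icc 1 N, truncation (Z k) k ω -
    ∑ k ∈ Finset.Icc 1 N, ∫ ω', truncation (Z k) k ω' ∂μ with hD
  have hDm : ∀ N, Measurable (D N) := fun N =>
    (Finset.measurable_fun_sum _ fun k _ => hY k).sub_const _
  have hev : ∀ N, evariance (∑ k ∈ Finset.Icc 1 N, truncation (Z k) k) μ =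
      ∫⁻ ω, ‖D N ω‖ₑ ^ 2 ∂μ := fun N => by
    simp only [evariance, hD, Finset.sum_apply]
    rw [integral_finsetSum _ fun k _ => hI k]
  have hbound : ∑' n : ℕ, ∫⁻ ω, ‖D ⌊c ^ n⌋₊ ω / (⌊c ^ n⌋₊ : ℝ)‖ₑ ^ 2 ∂μ ≤
      2 * (C * ∫⁻ t in Set.Ioi (0 : ℝ), g t) := by
    calc ∑' n : ℕ, ∫⁻ ω, ‖D ⌊c ^ n⌋₊ ω / (⌊c ^ n⌋₊ : ℝ)‖ₑ ^ 2 ∂μ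
        ≤ ∑' n : ℕ, 2 * ∫⁻ t in Set.Ioi (0 : ℝ), (g t * (ENNReal.ofReal t *
          if t < (⌊c ^ n⌋₊ : ℝ) then ((⌊c ^ n⌋₊ : ℝ≥0∞))⁻¹ else 0)) := by
          refine ENNReal.tsum_le_tsum fun n => ?_
          have hne : (⌊c ^ n⌋₊ : ℝ≥0∞) ≠ 0 := by
            have := hk1 n
            exact_mod_cast (by omega : ⌊c ^ n⌋₊ ≠ 0)
          have hneR : (⌊c ^ n⌋₊ : ℝ) ≠ 0 := by exact_mod_cast hne
          have hev' := evariance_sum_truncation_le hmeas h0 hindep hg hZg ⌊c ^ n⌋₊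
          generalize ⌊c ^ n⌋₊ = N at hne hneR hev' ⊢
          have hdiv : ∀ ω, ‖D N ω / (N : ℝ)‖ₑ ^ 2 = ((N : ℝ≥0∞)⁻¹) ^ 2 * ‖D N ω‖ₑ ^ 2 := by
            intro ω
            rw [div_eq_mul_inv, enorm_mul, enorm_inv hneR, mul_pow, mul_comm]
            simp
          simp_rw [hdiv]
          rw [lintegral_const_mul _ ((hDm N).enorm.pow_const 2), ← hev]
          have hcancel : ((N : ℝ≥0∞)⁻¹) ^ 2 * N = (N : ℝ≥0∞)⁻¹ := by
            rw [sq, mul_assoc, ENNReal.inv_mul_cancel hne (ENNReal.natCast_ne_top N), mul_one]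
          calc ((N : ℝ≥0∞)⁻¹) ^ 2 * evariance (∑ k ∈ Finset.Icc 1 N, truncation (Z k) k) μ
              ≤ ((N : ℝ≥0∞)⁻¹) ^ 2 * (N * (2 * ∫⁻ t in Set.Ioi (0 : ℝ),
                (Set.Iio (N : ℝ)).indicator (fun t => g t * ENNReal.ofReal t) t)) := by
                gcongr
            _ = 2 * ((N : ℝ≥0∞)⁻¹ * ∫⁻ t in Set.Ioi (0 : ℝ),
                (Set.Iio (N : ℝ)).indicator (fun t => g t * ENNReal.ofReal t) t) := by
                rw [← mul_assoc, hcancel, mul_left_comm]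
            _ = _ := by
                rw [← lintegral_const_mul _
                  (Measurable.indicator (f := fun t => g t * ENNReal.ofReal t)
            (hg.mul ENNReal.measurable_ofReal) measurableSet_Iio)]
                congr 2
                ext t
                by_cases htN : t < N
                · simp only [Set.indicator_of_mem (Set.mem_Iio.2 htN), if_pos htN]
                  ring
                · simp [htN]
      _ = 2 * ∫⁻ t in Set.Ioi (0 : ℝ), (g t * (ENNReal.ofReal t *
          ∑' n : ℕ, if t < (⌊c ^ n⌋₊ : ℝ) then ((⌊c ^ n⌋₊ : ℝ≥0∞))⁻¹ else 0)) := by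
          rw [ENNReal.tsum_mul_left, ← lintegral_tsum]
          · simp_rw [ENNReal.tsum_mul_left]
          · exact fun n => (hg.mul (ENNReal.measurable_ofReal.mul
              (Measurable.ite measurableSet_Iio measurable_const measurable_const))).aemeasurable
      _ ≤ 2 * ∫⁻ t in Set.Ioi (0 : ℝ), C * g t := by
          gcongr 2 * ?_
          refine setLIntegral_mono' measurableSet_Ioi fun t (ht : 0 < t) => ?_
          rw [mul_comm]
          gcongr
          exact hCle t ht
      _ = _ := by rw [lintegral_const_mul _ hg]
  rw [← lintegral_tsum fun n =>
    (((hDm _).div_const _).enorm.pow_const 2).aemeasurable] at hbound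
  have hlt := ae_lt_top (Measurable.tsum fun n =>
    (((hDm ⌊c ^ n⌋₊).div_const (⌊c ^ n⌋₊ : ℝ)).enorm.pow_const 2))
    (ne_top_of_le_ne_top (ENNReal.mul_ne_top (by simp) (ENNReal.mul_ne_top hC hfin)) hbound)
  filter_upwards [hlt] with ω hω
  have h := ENNReal.tendsto_atTop_zero_of_tsum_ne_top hω.ne
  have h2 := h.ennrpow_const (1 / 2 : ℝ)
  simp only [← ENNReal.rpow_natCast, ← ENNReal.rpow_mul] at h2
  rw [tendsto_zero_iff_enorm_tendsto_zero]
  simpa using h2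

/-- The strong law for nonnegative variables whose tails are dominated in Cesàro mean by an
integrable function. -/
lemma ae_tendsto_sum_sub_integral_div_of_nonneg [IsProbabilityMeasure μ]
    (hmeas : ∀ n, Measurable (Z n))
    (h0 : ∀ n ω, 0 ≤ Z n ω) (hindep : ∀ i j, i ≠ j → IndepFun (Z i) (Z j) μ)
    (hint : ∀ n, 1 ≤ n → Integrable (Z n) μ)
    (hg : Measurable g) (hfin : ∫⁻ t in Set.Ioi (0 : ℝ), g t ≠ ⊤)
    (hZg : ∀ (n : ℕ) (t : ℝ), 0 < t → ∑ k ∈ Finset.Icc 1 n, μ {ω | t < Z k ω} ≤ n * g t)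
    (hsum : ∑' n : ℕ, μ {ω | ((n + 1 : ℕ) : ℝ) < Z (n + 1) ω} ≠ ⊤) :
    ∀ᵐ ω ∂μ, Tendsto (fun n : ℕ =>
      (∑ k ∈ Finset.Icc 1 n, Z k ω - ∑ k ∈ Finset.Icc 1 n, ∫ ω', Z k ω' ∂μ) / (n : ℝ))
      atTop (nhds 0) := by
  have hI : ∀ k, Integrable (truncation (Z k) k) μ := fun k =>
    (hmeas k).aestronglyMeasurable.integrable_truncation
  have hY0 : ∀ k ω, 0 ≤ truncation (Z k) k ω := fun k ω => truncation_nonneg _ (h0 k ω)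
  have hYle : ∀ k ω, truncation (Z k) k ω ≤ Z k ω := fun k ω => by
    have := abs_truncation_le_abs_self (Z k) k ω
    rw [abs_of_nonneg (h0 k ω)] at this
    exact (le_abs_self _).trans this
  have hYeq : ∀ k ω, Z k ω ≤ k → truncation (Z k) k ω = Z k ω := by
    intro k ω h
    rw [truncation_eq_of_nonneg (h0 k)]
    rcases (h0 k ω).eq_or_lt with h' | h'
    · simp [← h']
    · simp [Set.indicator_of_mem (show Z k ω ∈ Set.Ioc (0 : ℝ) k from ⟨h', h⟩)]
  have hmono : ∀ f : ℕ → ℝ, (∀ k, 0 ≤ f k) → Monotone fun n => ∑ k ∈ Finset.Icc 1 n, f k :=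
    fun f hf a b hab => Finset.sum_le_sum_of_subset_of_nonneg
      (Finset.Icc_subset_Icc_right hab) fun k _ _ => hf k
  have hT : ∀ (M : ℝ) k, 1 ≤ k → Integrable (fun ω => max (Z k ω - M) 0) μ := fun M k hk =>
    ((hint k hk).sub (integrable_const M)).pos_part
  -- increments of the truncated means
  have hinc : ∀ η : ℝ, 0 < η → ∃ M : ℝ, 0 ≤ M ∧ ∀ N N' : ℕ, N ≤ N' →
      ∑ k ∈ Finset.Icc 1 N', ∫ ω, truncation (Z k) k ω ∂μ -
        ∑ k ∈ Finset.Icc 1 N, ∫ ω, truncation (Z k) k ω ∂μ ≤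
          M * ((N' : ℝ) - N) + η * N' := by
    intro η hη
    obtain ⟨M, hM, h⟩ := exists_sum_integral_max_sub_le hmeas hint hg hfin hZg hη
    refine ⟨M, hM, fun N N' hN => ?_⟩
    have hsub : Finset.Icc 1 N ⊆ Finset.Icc 1 N' := Finset.Icc_subset_Icc_right hN
    rw [← Finset.sum_sdiff hsub, add_sub_cancel_right]
    calc ∑ k ∈ Finset.Icc 1 N' \ Finset.Icc 1 N, ∫ ω, truncation (Z k) k ω ∂μ
        ≤ ∑ k ∈ Finset.Icc 1 N' \ Finset.Icc 1 N, (M + ∫ ω, max (Z k ω - M) 0 ∂μ) := by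
          refine Finset.sum_le_sum fun k hk => ?_
          have hk1 : 1 ≤ k := (Finset.mem_Icc.1 (Finset.mem_sdiff.1 hk).1).1
          calc ∫ ω, truncation (Z k) k ω ∂μ ≤ ∫ ω, (M + max (Z k ω - M) 0) ∂μ :=
                integral_mono (hI k) ((integrable_const M).add (hT M k hk1)) fun ω => by
                  have := hYle k ω
                  have := le_max_left (Z k ω - M) 0
                  simp only
                  linarith
            _ = _ := by
                rw [integral_add (integrable_const M) (hT M k hk1)]
                simp
      _ ≤ M * ((N' : ℝ) - N) + η * N' := by
          rw [Finset.sum_add_distrib, Finset.sum_const, Finset.card_sdiff_of_subset hsub]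
          have h1 : ∑ k ∈ Finset.Icc 1 N' \ Finset.Icc 1 N, ∫ ω, max (Z k ω - M) 0 ∂μ ≤
              ∑ k ∈ Finset.Icc 1 N', ∫ ω, max (Z k ω - M) 0 ∂μ :=
            Finset.sum_le_sum_of_subset_of_nonneg Finset.sdiff_subset fun k _ _ =>
              integral_nonneg (f := fun ω => max (Z k ω - M) 0) fun ω => le_max_right _ _
          have h2 := h N'
          simp only [Nat.card_Icc, Nat.add_sub_cancel, nsmul_eq_mul, Nat.cast_sub hN]
          linarith
  -- truncation is harmless in mean
  have hmean : Tendsto (fun n : ℕ => (∑ k ∈ Finset.Icc 1 n,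
      ∫ ω, (Z k ω - truncation (Z k) k ω) ∂μ) / (n : ℝ)) atTop (nhds 0) := by
    rw [Metric.tendsto_atTop]
    intro ε hε
    obtain ⟨M, hM, h⟩ := exists_sum_integral_max_sub_le hmeas hint hg hfin hZg
      (show 0 < ε / 8 by positivity)
    obtain ⟨m, hm⟩ := exists_nat_ge (2 * M)
    obtain ⟨n₀, hn₀⟩ := exists_nat_gt (M * m / (ε / 4))
    refine ⟨max n₀ 1, fun n hn => ?_⟩
    have hn1 : (1 : ℝ) ≤ n := by exact_mod_cast (le_max_right _ _).trans hn
    have hn2 : (n₀ : ℝ) ≤ n := by exact_mod_cast (le_max_left _ _).trans hn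
    have hpt : ∀ k, 1 ≤ k → ∫ ω, (Z k ω - truncation (Z k) k ω) ∂μ ≤
        2 * (∫ ω, max (Z k ω - M) 0 ∂μ) + if k < m then M else 0 := by
      intro k hk
      calc ∫ ω, (Z k ω - truncation (Z k) k ω) ∂μ
          ≤ ∫ ω, (2 * max (Z k ω - M) 0 + if k < m then M else 0) ∂μ := by
            refine integral_mono ((hint k hk).sub (hI k))
              (((hT M k hk).const_mul 2).add (integrable_const _)) fun ω => ?_
            have h1 := le_max_left (Z k ω - M) 0
            have h2 := le_max_right (Z k ω - M) 0
            have h3 := hY0 k ω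
            simp only
            split_ifs with hkm
            · linarith
            · have hkm' : (m : ℝ) ≤ k := by exact_mod_cast not_lt.1 hkm
              by_cases hle : Z k ω ≤ k
              · rw [hYeq k ω hle]
                linarith
              · linarith [not_le.1 hle]
        _ = _ := by
            rw [integral_add ((hT M k hk).const_mul 2) (integrable_const _),
              integral_const_mul]
            simp
    have hnonneg : 0 ≤ ∑ k ∈ Finset.Icc 1 n, ∫ ω, (Z k ω - truncation (Z k) k ω) ∂μ :=
      Finset.sum_nonneg fun k _ => integral_nonneg fun ω => sub_nonneg.2 (hYle k ω)
    rw [dist_zero_right, Real.norm_eq_abs, abs_div, Nat.abs_cast, abs_of_nonneg hnonneg,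
      div_lt_iff₀ (by linarith)]
    have hcard : ∑ k ∈ Finset.Icc 1 n, (if k < m then M else 0) ≤ M * m := by
      rw [← Finset.sum_filter, Finset.sum_const, nsmul_eq_mul, mul_comm]
      gcongr
      calc ((Finset.Icc 1 n).filter (· < m)).card ≤ (Finset.range m).card :=
            Finset.card_le_card fun k hk => Finset.mem_range.2 (Finset.mem_filter.1 hk).2
        _ = m := Finset.card_range m
    have htot := Finset.sum_le_sum fun k (hk : k ∈ Finset.Icc 1 n) =>
      hpt k (Finset.mem_Icc.1 hk).1
    rw [Finset.sum_add_distrib, ← Finset.mul_sum] at htot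
    have hn' := h n
    rw [div_lt_iff₀ (by positivity)] at hn₀
    have h5 := mul_le_mul_of_nonneg_right hn2 (show 0 ≤ ε / 4 by positivity)
    have h6 : 0 < ε * n := by positivity
    linarith
  have hsubseq : ∀ᵐ ω ∂μ, ∀ j : ℕ, _ := ae_all_iff.2 fun j : ℕ =>
    ae_tendsto_sum_truncation_floor_pow hmeas h0 hindep hg hfin hZg
      (c := 1 + 1 / ((j : ℝ) + 1)) (by
        have : 0 < 1 / ((j : ℝ) + 1) := by positivity
        linarith)
  filter_upwards [hsubseq, ae_eventually_notMem hsum] with ω hω hBC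
  have hY := tendsto_sub_div_of_tendsto_floor_pow (hmono _ fun k => hY0 k ω)
    (hmono _ fun k => integral_nonneg (hY0 k)) hinc hω
  have hdiff : Tendsto (fun n : ℕ => (∑ k ∈ Finset.Icc 1 n,
      (Z k ω - truncation (Z k) k ω)) / (n : ℝ)) atTop (nhds 0) := by
    obtain ⟨n₀, hn₀⟩ := eventually_atTop.1 hBC
    refine (tendsto_const_div_atTop_nhds_zero_nat
      (∑ k ∈ Finset.Icc 1 n₀, (Z k ω - truncation (Z k) k ω))).congr' ?_
    filter_upwards [eventually_ge_atTop n₀] with n hn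
    congr 1
    refine Finset.sum_subset (Finset.Icc_subset_Icc_right hn) fun k hk hk' => ?_
    simp only [Finset.mem_Icc, not_and, not_le] at hk hk'
    have h1 := hn₀ (k - 1) (by have := hk' hk.1; omega)
    simp only [Nat.sub_add_cancel hk.1, not_lt] at h1
    rw [hYeq k ω h1, sub_self]
  have hfinal := (hY.add hdiff).sub hmean
  rw [add_zero, sub_zero] at hfinal
  refine hfinal.congr fun n => ?_
  have : ∑ k ∈ Finset.Icc 1 n, ∫ ω, (Z k ω - truncation (Z k) k ω) ∂μ =
      ∑ k ∈ Finset.Icc 1 n, (∫ ω, Z k ω ∂μ - ∫ ω, truncation (Z k) k ω ∂μ) :=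
    Finset.sum_congr rfl fun k hk => integral_sub (hint k (Finset.mem_Icc.1 hk).1) (hI k)
  rw [this, Finset.sum_sub_distrib, Finset.sum_sub_distrib]
  ring

end Nonneg

/-- Bose–Chandra: if `G x = sup_{n ≥ 1} (1/n) ∑_{k=1}^n P(|X_k| > x)` satisfies
`∫_0^∞ G < ∞` and `∑_{n=1}^∞ P(|X_n| > n) < ∞`, then `(S_n - E S_n)/n → 0` a.s. -/
theorem bose_chandra_slln {Ω : Type*} [MeasurableSpace Ω] (μ : Measure Ω)
    [IsProbabilityMeasure μ]
    (X : ℕ → Ω → ℝ) (hmeas : ∀ n, Measurable (X n))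
    (hindep : ∀ i j, i ≠ j → IndepFun (X i) (X j) μ)
    (hint : ∀ n, 1 ≤ n → Integrable (X n) μ)
    (hG : (∫⁻ x in Set.Ioi (0 : ℝ), ⨆ n, ⨆ (_ : 1 ≤ n),
        (∑ k ∈ Finset.Icc 1 n, μ {ω | x < |X k ω|}) / (n : ℝ≥0∞)) < ⊤)
    (hsum : (∑' n : ℕ, μ {ω | ((n + 1 : ℕ) : ℝ) < |X (n + 1) ω|}) < ⊤) :
    ∀ᵐ ω ∂μ, Tendsto
      (fun n : ℕ => ((∑ k ∈ Finset.Icc 1 n, X k ω)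
        - ∫ ω', ∑ k ∈ Finset.Icc 1 n, X k ω' ∂μ) / (n : ℝ))
      atTop (nhds 0) := by
  set g : ℝ → ℝ≥0∞ := fun x => ⨆ n, ⨆ (_ : 1 ≤ n),
    (∑ k ∈ Finset.Icc 1 n, μ {ω | x < |X k ω|}) / (n : ℝ≥0∞) with hgdef
  have hg : Measurable g := by
    refine Antitone.measurable fun s t hst => ?_
    refine iSup₂_mono fun n _ => ?_
    gcongr
  have hXg : ∀ (n : ℕ) (t : ℝ), ∑ k ∈ Finset.Icc 1 n, μ {ω | t < |X k ω|} ≤ n * g t := by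
    intro n t
    rcases Nat.eq_zero_or_pos n with rfl | hn
    · simp
    · rw [mul_comm, ← ENNReal.div_le_iff (by exact_mod_cast hn.ne') (ENNReal.natCast_ne_top n)]
      exact le_iSup₂_of_le (f := fun n (_ : 1 ≤ n) =>
        (∑ k ∈ Finset.Icc 1 n, μ {ω | t < |X k ω|}) / (n : ℝ≥0∞)) n hn le_rfl
  have main : ∀ φ : ℝ → ℝ, Measurable φ → (∀ x, 0 ≤ φ x) → (∀ x, φ x ≤ |x|) →
      ∀ᵐ ω ∂μ, Tendsto (fun n : ℕ => (∑ k ∈ Finset.Icc 1 n, φ (X k ω) -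
        ∑ k ∈ Finset.Icc 1 n, ∫ ω', φ (X k ω') ∂μ) / (n : ℝ)) atTop (nhds 0) := by
    intro φ hφ hφ0 hφle
    have hsub : ∀ (k : ℕ) (t : ℝ), μ {ω | t < φ (X k ω)} ≤ μ {ω | t < |X k ω|} :=
      fun k t => measure_mono fun ω (h : t < φ (X k ω)) => h.trans_le (hφle _)
    refine ae_tendsto_sum_sub_integral_div_of_nonneg (Z := fun k ω => φ (X k ω)) (g := g)
      (fun n => hφ.comp (hmeas n)) (fun n ω => hφ0 _)
      (fun i j hij => (hindep i j hij).comp hφ hφ) (fun n hn => ?_) hg hG.ne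
      (fun n t _ => (Finset.sum_le_sum fun k _ => hsub k t).trans (hXg n t))
      (ne_top_of_le_ne_top hsum.ne (ENNReal.tsum_le_tsum fun n => hsub _ _))
    refine (hint n hn).mono (hφ.comp (hmeas n)).aestronglyMeasurable (ae_of_all _ fun ω => ?_)
    rw [Real.norm_eq_abs, Real.norm_eq_abs, abs_of_nonneg (hφ0 _)]
    exact hφle _
  filter_upwards [main (fun x => max x 0) (measurable_id.max measurable_const)
      (fun x => le_max_right _ _) (fun x => max_le (le_abs_self x) (abs_nonneg x)),
    main (fun x => max (-x) 0) (measurable_neg.max measurable_const)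
      (fun x => le_max_right _ _) (fun x => max_le (neg_le_abs x) (abs_nonneg x))] with ω h1 h2
  have h := h1.sub h2
  rw [sub_zero] at h
  refine h.congr fun n => ?_
  have hE : ∑ k ∈ Finset.Icc 1 n, ∫ ω', X k ω' ∂μ =
      ∑ k ∈ Finset.Icc 1 n, (∫ ω', max (X k ω') 0 ∂μ - ∫ ω', max (-X k ω') 0 ∂μ) := by
    refine Finset.sum_congr rfl fun k hk => ?_
    have hi := hint k (Finset.mem_Icc.1 hk).1
    rw [← integral_sub hi.pos_part hi.neg_part]
    simp_rw [max_zero_sub_max_neg_zero_eq_self]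
  have hS : ∑ k ∈ Finset.Icc 1 n, X k ω =
      ∑ k ∈ Finset.Icc 1 n, (max (X k ω) 0 - max (-X k ω) 0) := by
    simp_rw [max_zero_sub_max_neg_zero_eq_self]
  rw [integral_finsetSum _ fun k hk => hint k (Finset.mem_Icc.1 hk).1, hE, hS,
    Finset.sum_sub_distrib, Finset.sum_sub_distrib]
  ring
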